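/- Let a, b_1,…,b_s ∈ ℓ¹(ℤ^d) and M, M_1,…,M_s be invertible integer matrices. The filter bank {a@M; b_1@M_1,…,b_s@M_s} is a tight framelet filter bank with mixed sampling factors if and only if the system {a_{1;k} : k ∈ ℤ^d} ∪ {b_{ℓ,1;k} : k ∈ ℤ^d, ℓ = 1,…,s}, where a_{1;k} := |det M|^{1/2} a(·−Mk) and b_{ℓ,1;k} := |det M_ℓ|^{1/2} b_ℓ(·−M_ℓ k), is a normalized tight frame for ℓ²(ℤ^d): ‖v‖² = Σ_k |⟨v, a_{1;k}⟩|² + Σ_ℓ Σ_k |⟨v, b_{ℓ,1;k}⟩|² for all v ∈ ℓ²(ℤ^d). -/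

import Mathlib

open scoped BigOperators
open MeasureTheory Classical

/-- Fourier series `û(ξ) = Σ_{k∈ℤ^d} u(k) e^{-ik·ξ}`. -/
noncomputable def fserd {d : ℕ} (u : (Fin d → ℤ) → ℂ) (ξ : Fin d → ℝ) : ℂ :=
  ∑' k : Fin d → ℤ, u k * Complex.exp (-(Complex.I * ((∑ i, (k i : ℝ) * ξ i : ℝ) : ℂ)))

/-- `ω ∈ N^{-T} ℤ^d`, i.e. `Nᵀ ω ∈ ℤ^d`. -/
def inLat {d : ℕ} (N : Matrix (Fin d) (Fin d) ℤ) (ω : Fin d → ℝ) : Prop :=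
  ∃ k : Fin d → ℤ, (N.map (Int.cast : ℤ → ℝ)).transpose.mulVec ω = fun i => (k i : ℝ)

/-- `Ω_N = (N^{-T} ℤ^d) ∩ [0,1)^d`. -/
def Omega {d : ℕ} (N : Matrix (Fin d) (Fin d) ℤ) : Set (Fin d → ℝ) :=
  {ω | inLat N ω ∧ ∀ i, ω i ∈ Set.Ico (0 : ℝ) 1}

/-- Inner product `⟨u,w⟩ = Σ_k u(k) conj (w(k))` on ℓ²(ℤ^d). -/
noncomputable def ip {d : ℕ} (u w : (Fin d → ℤ) → ℂ) : ℂ :=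
  ∑' k : Fin d → ℤ, u k * starRingEnd ℂ (w k)

/-- The character `e^{-i k·ξ}`. -/
noncomputable def ech {d : ℕ} (k : Fin d → ℤ) (ξ : Fin d → ℝ) : ℂ :=
  Complex.exp (-(Complex.I * ((∑ i, (k i : ℝ) * ξ i : ℝ) : ℂ)))

lemma fserd_eq {d : ℕ} (u : (Fin d → ℤ) → ℂ) (ξ : Fin d → ℝ) :
    fserd u ξ = ∑' k, u k * ech k ξ := rfl

lemma norm_ech {d : ℕ} (k : Fin d → ℤ) (ξ : Fin d → ℝ) : ‖ech k ξ‖ = 1 := by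
  unfold ech
  rw [show -(Complex.I * ((∑ i, (k i : ℝ) * ξ i : ℝ) : ℂ)) =
    ((-(∑ i, (k i : ℝ) * ξ i) : ℝ) : ℂ) * Complex.I by push_cast; ring]
  exact Complex.norm_exp_ofReal_mul_I _

lemma conj_ech {d : ℕ} (k : Fin d → ℤ) (ξ : Fin d → ℝ) :
    starRingEnd ℂ (ech k ξ) = ech (-k) ξ := by
  unfold ech
  rw [← Complex.exp_conj]
  simp

lemma ech_add {d : ℕ} (k l : Fin d → ℤ) (ξ : Fin d → ℝ) :
    ech (k + l) ξ = ech k ξ * ech l ξ := by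
  unfold ech
  rw [← Complex.exp_add]
  congr 1
  simp only [Pi.add_apply, Int.cast_add, add_mul, Finset.sum_add_distrib]
  push_cast; ring

lemma ech_add_right {d : ℕ} (k : Fin d → ℤ) (ξ η : Fin d → ℝ) :
    ech k (ξ + η) = ech k ξ * ech k η := by
  unfold ech
  rw [← Complex.exp_add]
  congr 1
  simp only [Pi.add_apply, mul_add, Finset.sum_add_distrib]
  push_cast; ring

lemma ech_zero_left {d : ℕ} (ξ : Fin d → ℝ) : ech (0 : Fin d → ℤ) ξ = 1 := by
  simp [ech]

lemma ech_zero_right {d : ℕ} (k : Fin d → ℤ) : ech k (0 : Fin d → ℝ) = 1 := by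
  simp [ech]

lemma summable_ech {d : ℕ} {u : (Fin d → ℤ) → ℂ} (hu : Summable fun k => ‖u k‖)
    (ξ : Fin d → ℝ) : Summable fun k => u k * ech k ξ := by
  apply Summable.of_norm
  simpa [norm_ech] using hu

lemma continuous_fserd {d : ℕ} {u : (Fin d → ℤ) → ℂ} (hu : Summable fun k => ‖u k‖) :
    Continuous (fserd u) := by
  refine continuous_tsum (u := fun k => ‖u k‖) (fun k => by fun_prop) hu (fun k ξ => ?_)
  have := norm_ech k ξ
  unfold ech at this
  rw [norm_mul, this, mul_one]

section torus

noncomputable local instance torusMS : MeasureSpace UnitAddCircle := ⟨AddCircle.haarAddCircle⟩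

local instance torusHaar : Measure.IsAddHaarMeasure (volume : Measure UnitAddCircle) :=
  inferInstanceAs (Measure.IsAddHaarMeasure AddCircle.haarAddCircle)

local instance torusProb : IsProbabilityMeasure (volume : Measure UnitAddCircle) :=
  inferInstanceAs (IsProbabilityMeasure AddCircle.haarAddCircle)

lemma mFourier_coe {d : ℕ} (n : Fin d → ℤ) (x : Fin d → ℝ) :
    UnitAddTorus.mFourier n (fun i => (x i : UnitAddCircle)) =
      ech (-n) ((2 * Real.pi) • x) := by
  simp only [UnitAddTorus.mFourier, ContinuousMap.coe_mk, fourier_coe_apply, ech]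
  rw [← Complex.exp_sum]
  congr 1
  push_cast
  rw [Finset.mul_sum, ← Finset.sum_neg_distrib]
  refine Finset.sum_congr rfl fun i _ => ?_
  simp
  ring

lemma coeff_zero_of_fserd {d : ℕ} {c : (Fin d → ℤ) → ℂ} (hc : Summable fun k => ‖c k‖)
    (h : ∀ ξ, fserd c ξ = 0) : c = 0 := by
  have hs : Summable fun k => c (-k) • UnitAddTorus.mFourier (d := Fin d) k := by
    apply Summable.of_norm
    simp only [norm_smul, UnitAddTorus.mFourier_norm, mul_one]
    exact (Equiv.neg (Fin d → ℤ)).summable_iff.mpr hc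
  have h0 : ∑' k, c (-k) • UnitAddTorus.mFourier (d := Fin d) k = 0 := by
    ext x
    obtain ⟨y, rfl⟩ : ∃ y : Fin d → ℝ, (fun i => (y i : UnitAddCircle)) = x := by
      choose y hy using fun i => QuotientAddGroup.mk_surjective (x i)
      exact ⟨y, funext hy⟩
    rw [← ContinuousMap.tsum_apply hs]
    simp only [ContinuousMap.coe_smul, Pi.smul_apply, mFourier_coe, smul_eq_mul,
      ContinuousMap.zero_apply]
    rw [← h ((2 * Real.pi) • y), fserd_eq]
    exact (Equiv.neg (Fin d → ℤ)).tsum_eq (fun k => c k * ech k ((2 * Real.pi) • y))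
  have hs' := hs.hasSum
  rw [h0] at hs'
  have h1 := hs'.mapL (ContinuousMap.toLp (E := ℂ) 2 (volume : Measure (UnitAddTorus (Fin d))) ℂ)
  simp only [map_smul, map_zero] at h1
  funext n
  have h2 := h1.mapL (innerSL ℂ (UnitAddTorus.mFourierLp (d := Fin d) 2 (-n)))
  have ho := orthonormal_iff_ite.mp (UnitAddTorus.orthonormal_mFourier (d := Fin d)) (-n)
  simp only [map_smul, map_zero, innerSL_apply_apply] at h2
  have h3 : HasSum (fun k : Fin d → ℤ => c (-k) • (if -n = k then (1 : ℂ) else 0)) 0 := by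
    have he : (fun k : Fin d → ℤ => c (-k) • (if -n = k then (1 : ℂ) else 0)) = _ :=
      funext fun k => by rw [← ho k]
    rw [he]
    exact h2
  have h4 := h3.unique (hasSum_single (-n) (fun k hk => by rw [if_neg (Ne.symm hk), smul_zero]))
  simpa using h4.symm

end torus

lemma coeff_zero_of_ae {d : ℕ} {c : (Fin d → ℤ) → ℂ} (hc : Summable fun k => ‖c k‖)
    (h : ∀ᵐ ξ : Fin d → ℝ ∂volume, fserd c ξ = 0) : c = 0 := by
  refine coeff_zero_of_fserd hc fun ξ => ?_
  have := (continuous_fserd hc).ae_eq_iff_eq (μ := volume) (g := fun _ => (0 : ℂ))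
    continuous_const |>.mp h
  exact congrFun this ξ

lemma fserd_single {d : ℕ} (z : ℂ) (ξ : Fin d → ℝ) : fserd (Pi.single 0 z) ξ = z := by
  rw [fserd_eq, tsum_eq_single 0]
  · simp [ech_zero_left]
  · intro k hk; simp [hk]

/-- correlation coefficients -/
noncomputable def corr {d : ℕ} (u : (Fin d → ℤ) → ℂ) (ω : Fin d → ℝ) (p : Fin d → ℤ) : ℂ :=
  ∑' j, u (j + p) * starRingEnd ℂ (u j) * ech (-j) ((2 * Real.pi) • ω)

lemma corr_summable_prod {d : ℕ} {u : (Fin d → ℤ) → ℂ} (hu : Summable fun k => ‖u k‖) :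
    Summable fun q : (Fin d → ℤ) × (Fin d → ℤ) => ‖u (q.2 + q.1)‖ * ‖u q.2‖ := by
  have h := hu.mul_of_nonneg hu (fun _ => norm_nonneg _) (fun _ => norm_nonneg _)
  let e : (Fin d → ℤ) × (Fin d → ℤ) ≃ (Fin d → ℤ) × (Fin d → ℤ) :=
    { toFun := fun q => (q.2 + q.1, q.2)
      invFun := fun q => (q.1 - q.2, q.2)
      left_inv := fun q => by simp
      right_inv := fun q => by simp }
  exact e.summable_iff.mpr h

lemma corr_summable {d : ℕ} {u : (Fin d → ℤ) → ℂ} (hu : Summable fun k => ‖u k‖)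
    (ω : Fin d → ℝ) : Summable fun p => ‖corr u ω p‖ := by
  have h := corr_summable_prod hu
  refine Summable.of_nonneg_of_le (fun _ => norm_nonneg _) (fun p => ?_) h.prod
  refine (norm_tsum_le_tsum_norm ?_).trans_eq ?_
  · simpa [norm_ech] using h.prod_factor p
  · simp [norm_ech]

lemma fserd_mul_conj {d : ℕ} {u : (Fin d → ℤ) → ℂ} (hu : Summable fun k => ‖u k‖)
    (ω ξ : Fin d → ℝ) :
    fserd u ξ * starRingEnd ℂ (fserd u (ξ + (2 * Real.pi) • ω)) = fserd (corr u ω) ξ := by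
  have h := corr_summable_prod hu
  let e : (Fin d → ℤ) × (Fin d → ℤ) ≃ (Fin d → ℤ) × (Fin d → ℤ) :=
    { toFun := fun q => (q.2 + q.1, q.2)
      invFun := fun q => (q.1 - q.2, q.2)
      left_inv := fun q => by simp
      right_inv := fun q => by simp }
  set η := (2 * Real.pi) • ω
  rw [fserd_eq, fserd_eq, Complex.conj_tsum]
  have hn1 : Summable fun k => ‖u k * ech k ξ‖ := by simpa [norm_ech] using hu
  have hn2 : Summable fun k => ‖starRingEnd ℂ (u k * ech k (ξ + η))‖ := by
    simpa [norm_ech] using hu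
  rw [tsum_mul_tsum_of_summable_norm hn1 hn2, ← e.tsum_eq]
  rw [Summable.tsum_prod]
  · rw [fserd_eq]
    refine tsum_congr fun p => ?_
    rw [corr, ← tsum_mul_right]
    refine tsum_congr fun j => ?_
    simp only [e, Equiv.coe_fn_mk, map_mul, conj_ech, ech_add_right, ech_add]
    have : ech j ξ * ech (-j) ξ = 1 := by
      rw [← ech_add]; simp [ech_zero_left]
    linear_combination (u (j + p) * starRingEnd ℂ (u j) * ech p ξ * ech (-j) η) * this
  · apply Summable.of_norm
    refine h.congr fun q => ?_
    simp [e, norm_ech]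

/-- The real transpose of an integer matrix. -/
noncomputable def tr {d : ℕ} (N : Matrix (Fin d) (Fin d) ℤ) : Matrix (Fin d) (Fin d) ℝ :=
  (N.map (Int.cast : ℤ → ℝ)).transpose

lemma tr_det {d : ℕ} {N : Matrix (Fin d) (Fin d) ℤ} (hN : N.det ≠ 0) : IsUnit (tr N).det := by
  rw [tr, Matrix.det_transpose, show (N.map (Int.cast : ℤ → ℝ)).det = ((N.det : ℤ) : ℝ) from
    (Int.cast_det N).symm]
  exact isUnit_iff_ne_zero.mpr (by exact_mod_cast hN)

lemma tr_int {d : ℕ} (N : Matrix (Fin d) (Fin d) ℤ) (l : Fin d → ℤ) :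
    (tr N).mulVec (fun i => (l i : ℝ)) = fun i => ((N.transpose.mulVec l i : ℤ) : ℝ) := by
  funext i
  simp [tr, Matrix.mulVec, dotProduct]

lemma inLat_zero {d : ℕ} (N : Matrix (Fin d) (Fin d) ℤ) : inLat N 0 :=
  ⟨0, by simp [Matrix.mulVec_zero]; rfl⟩

lemma inLat_add {d : ℕ} {N : Matrix (Fin d) (Fin d) ℤ} {x y : Fin d → ℝ}
    (hx : inLat N x) (hy : inLat N y) : inLat N (x + y) := by
  obtain ⟨k, hk⟩ := hx
  obtain ⟨l, hl⟩ := hy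
  refine ⟨k + l, ?_⟩
  rw [Matrix.mulVec_add, hk, hl]
  funext i; simp

lemma inLat_sub {d : ℕ} {N : Matrix (Fin d) (Fin d) ℤ} {x y : Fin d → ℝ}
    (hx : inLat N x) (hy : inLat N y) : inLat N (x - y) := by
  obtain ⟨k, hk⟩ := hx
  obtain ⟨l, hl⟩ := hy
  refine ⟨k - l, ?_⟩
  rw [Matrix.mulVec_sub, hk, hl]
  funext i; simp

lemma inLat_int {d : ℕ} (N : Matrix (Fin d) (Fin d) ℤ) (l : Fin d → ℤ) :
    inLat N (fun i => (l i : ℝ)) := ⟨_, tr_int N l⟩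

/-- componentwise fractional part -/
noncomputable def fr {d : ℕ} (x : Fin d → ℝ) : Fin d → ℝ := fun i => Int.fract (x i)

lemma fr_eq {d : ℕ} (x : Fin d → ℝ) : fr x = x - fun i => ((⌊x i⌋ : ℤ) : ℝ) := by
  funext i; rfl

lemma fr_mem {d : ℕ} {N : Matrix (Fin d) (Fin d) ℤ} {x : Fin d → ℝ} (hx : inLat N x) :
    fr x ∈ Omega N := by
  refine ⟨?_, fun i => ⟨Int.fract_nonneg _, Int.fract_lt_one _⟩⟩
  rw [fr_eq]
  exact inLat_sub hx (inLat_int N _)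

lemma fr_congr {d : ℕ} {x y : Fin d → ℝ} (l : Fin d → ℤ) (h : ∀ i, x i = y i + l i) :
    fr x = fr y := by
  funext i; simp [fr, h i]

lemma fr_self {d : ℕ} {N : Matrix (Fin d) (Fin d) ℤ} {x : Fin d → ℝ} (hx : x ∈ Omega N) :
    fr x = x := by
  funext i
  exact Int.fract_eq_self.mpr (hx.2 i)

lemma ech_int {d : ℕ} (j l : Fin d → ℤ) :
    ech j ((2 * Real.pi) • fun i => (l i : ℝ)) = 1 := by
  unfold ech
  rw [Complex.exp_eq_one_iff]
  refine ⟨-∑ i, j i * l i, ?_⟩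
  push_cast
  rw [Finset.mul_sum, neg_mul, Finset.sum_mul]
  congr 1
  refine Finset.sum_congr rfl fun i _ => ?_
  simp
  ring

lemma ech_fr {d : ℕ} (j : Fin d → ℤ) (x : Fin d → ℝ) :
    ech j ((2 * Real.pi) • fr x) = ech j ((2 * Real.pi) • x) := by
  have h : x = fr x + fun i => ((⌊x i⌋ : ℤ) : ℝ) := by rw [fr_eq]; simp
  conv_rhs => rw [h, smul_add, ech_add_right, ech_int, mul_one]

lemma ech_eq_one {d : ℕ} {j : Fin d → ℤ} {x : Fin d → ℝ} (h : ech j ((2 * Real.pi) • x) = 1) :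
    ∃ n : ℤ, ∑ i, (j i : ℝ) * x i = n := by
  unfold ech at h
  rw [Complex.exp_eq_one_iff] at h
  obtain ⟨n, hn⟩ := h
  refine ⟨-n, ?_⟩
  have h2 : (((∑ i, (j i : ℝ) * ((2 * Real.pi) • x) i : ℝ)) : ℂ) = ((-n * (2 * Real.pi) : ℝ) : ℂ) := by
    have hI := Complex.I_ne_zero
    apply mul_left_cancel₀ hI
    push_cast at hn ⊢
    linear_combination -hn
  have h3 := Complex.ofReal_injective h2
  have h4 : ∑ i, (j i : ℝ) * ((2 * Real.pi) • x) i = (∑ i, (j i : ℝ) * x i) * (2 * Real.pi) := by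
    rw [Finset.sum_mul]
    refine Finset.sum_congr rfl fun i _ => ?_
    simp; ring
  rw [h4] at h3
  have := mul_right_cancel₀ (by positivity) h3
  push_cast; exact this

lemma card_Omega {d : ℕ} {N : Matrix (Fin d) (Fin d) ℤ} (hN : N.det ≠ 0) :
    Nat.card (Omega N) = N.det.natAbs := by
  let f : (Fin d → ℤ) →ₗ[ℤ] (Fin d → ℤ) := Matrix.toLin' N.transpose
  have hinj : Function.Injective f := by
    have : N.transpose.det ≠ 0 := by rwa [Matrix.det_transpose]
    exact Matrix.mulVec_injective_of_det_ne_zero this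
  let e : (Fin d → ℤ) ≃ₗ[ℤ] LinearMap.range f := LinearEquiv.ofInjective f hinj
  have h1 := Submodule.natAbs_det_equiv (LinearMap.range f) e
  have h2 : (LinearMap.range f).subtype ∘ₗ AddMonoidHom.toIntLinearMap
      (e : (Fin d → ℤ) →+ LinearMap.range f) = f := by
    ext x; rfl
  rw [h2, LinearMap.det_toLin', Matrix.det_transpose] at h1
  rw [h1]
  have hu := tr_det hN
  have hinjR : Function.Injective (tr N).mulVec :=
    Matrix.mulVec_injective_of_isUnit ((Matrix.isUnit_iff_isUnit_det _).mpr hu)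
  choose! κ hκ using fun (ω : Fin d → ℝ) (h : inLat N ω) => h
  refine Nat.card_congr (Equiv.ofBijective
    (fun ω : Omega N => Submodule.Quotient.mk (p := LinearMap.range f) (κ ω.1)) ⟨?_, ?_⟩)
  · rintro ⟨x, hx⟩ ⟨y, hy⟩ h
    have h' := (Submodule.Quotient.eq _).mp h
    obtain ⟨l, hl⟩ := h'
    have h3 : (tr N).mulVec (x - fun i => (l i : ℝ)) = (tr N).mulVec y := by
      rw [Matrix.mulVec_sub, tr_int]
      have e1 : (tr N).mulVec x = _ := hκ x hx.1
      have e2 : (tr N).mulVec y = _ := hκ y hy.1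
      rw [e1, e2]
      funext i
      have h4 : N.transpose.mulVec l i = κ x i - κ y i := congrFun hl i
      simp [h4]
    have h5 := hinjR h3
    have h6 : fr x = fr y := fr_congr l fun i => by rw [← h5]; simp
    rw [fr_self hx, fr_self hy] at h6
    exact Subtype.ext h6
  · intro q
    obtain ⟨k, rfl⟩ := Submodule.Quotient.mk_surjective _ q
    set x := (tr N)⁻¹.mulVec (fun i => (k i : ℝ)) with hx
    have hxk : (tr N).mulVec x = fun i => (k i : ℝ) := by
      rw [hx, Matrix.mulVec_mulVec, Matrix.mul_nonsing_inv _ hu, Matrix.one_mulVec]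
    have hxl : inLat N x := ⟨k, hxk⟩
    refine ⟨⟨fr x, fr_mem hxl⟩, ?_⟩
    refine (Submodule.Quotient.eq _).mpr ⟨fun i => -⌊x i⌋, ?_⟩
    have e1 : (tr N).mulVec (fr x) = _ := hκ (fr x) (fr_mem hxl).1
    rw [fr_eq, Matrix.mulVec_sub, hxk, tr_int, ← fr_eq] at e1
    funext i
    have e2 := congrFun e1 i
    simp only [Pi.sub_apply] at e2
    have e3 : (k i - N.transpose.mulVec (fun i => ⌊x i⌋) i) = κ (fr x) i := by exact_mod_cast e2
    change N.transpose.mulVec (fun i => -⌊x i⌋) i = κ (fr x) i - k i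
    rw [← e3, show (fun i => -⌊x i⌋) = -(fun i => ⌊x i⌋) from rfl, Matrix.mulVec_neg]
    simp

lemma finite_Omega {d : ℕ} {N : Matrix (Fin d) (Fin d) ℤ} (hN : N.det ≠ 0) :
    (Omega N).Finite := by
  have : Nat.card (Omega N) ≠ 0 := by
    rw [card_Omega hN]; exact Int.natAbs_ne_zero.mpr hN
  exact Nat.finite_of_card_ne_zero this

lemma ech_mulVec {d : ℕ} {N : Matrix (Fin d) (Fin d) ℤ} (k : Fin d → ℤ) {ω : Fin d → ℝ}
    (h : inLat N ω) : ech (N.mulVec k) ((2 * Real.pi) • ω) = 1 := by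
  obtain ⟨l, hl⟩ := h
  rw [← ech_int k l, ← hl]
  unfold ech
  congr 4
  have := Matrix.dotProduct_mulVec (fun i => (k i : ℝ)) (N.map (Int.cast : ℤ → ℝ)).transpose
    ((2 * Real.pi) • ω)
  rw [← Matrix.mulVec_smul]
  refine Eq.trans ?_ this.symm
  rw [Matrix.vecMul_transpose]
  refine Finset.sum_congr rfl fun i _ => ?_
  congr 1
  simp [Matrix.mulVec, dotProduct]

lemma sum_Omega {d : ℕ} {N : Matrix (Fin d) (Fin d) ℤ} (hN : N.det ≠ 0) (j : Fin d → ℤ) :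
    ∑ ω ∈ (finite_Omega hN).toFinset, ech j ((2 * Real.pi) • ω) =
      if ∃ k, j = N.mulVec k then ((|(N.det : ℝ)| : ℝ) : ℂ) else 0 := by
  split_ifs with h
  · obtain ⟨k, rfl⟩ := h
    rw [Finset.sum_congr rfl (g := fun _ => (1 : ℂ))]
    · rw [Finset.sum_const, ← Nat.card_eq_card_finite_toFinset, card_Omega hN, nsmul_eq_mul, mul_one]
      rw [Nat.cast_natAbs, ← Int.cast_abs, Complex.ofReal_intCast]
    · intro ω hω
      exact ech_mulVec k ((Set.Finite.mem_toFinset _).mp hω).1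
  · obtain ⟨ω₀, h0, h1⟩ : ∃ ω₀, inLat N ω₀ ∧ ech j ((2 * Real.pi) • ω₀) ≠ 1 := by
      by_contra! hc
      apply h
      have hu := tr_det hN
      have hl : ∀ i, inLat N ((tr N)⁻¹.mulVec (Pi.single i 1)) := fun i => by
        refine ⟨Pi.single i 1, ?_⟩
        have : (tr N).mulVec ((tr N)⁻¹.mulVec (Pi.single i 1)) = Pi.single i 1 := by
          rw [Matrix.mulVec_mulVec, Matrix.mul_nonsing_inv _ hu, Matrix.one_mulVec]
        refine Eq.trans this ?_
        funext l
        by_cases hli : l = i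
        · subst hli; simp
        · simp [hli]
      choose k hk using fun i => ech_eq_one (hc _ (hl i))
      refine ⟨k, ?_⟩
      have h2 : Matrix.vecMul (fun i => (j i : ℝ)) (tr N)⁻¹ = fun i => (k i : ℝ) := by
        funext i
        rw [← hk i]
        simp [Matrix.vecMul, dotProduct]
      have h3 : (fun i => (j i : ℝ)) = Matrix.vecMul (fun i => (k i : ℝ)) (tr N) := by
        rw [← h2, Matrix.vecMul_vecMul, Matrix.nonsing_inv_mul _ hu, Matrix.vecMul_one]
      funext i
      have h4 := congrFun h3 i
      rw [tr, Matrix.vecMul_transpose] at h4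
      have h5 : (j i : ℝ) = ((N.mulVec k i : ℤ) : ℝ) := by
        rw [h4]; simp [Matrix.mulVec, dotProduct]
      exact_mod_cast h5
    set S := ∑ ω ∈ (finite_Omega hN).toFinset, ech j ((2 * Real.pi) • ω) with hS
    have h2 : S = S * ech j ((2 * Real.pi) • ω₀) := by
      conv_rhs => rw [hS, Finset.sum_mul]
      symm
      refine Finset.sum_nbij' (fun ω => fr (ω + ω₀)) (fun ω => fr (ω - ω₀)) ?_ ?_ ?_ ?_ ?_
      · intro ω hω
        rw [Set.Finite.mem_toFinset] at hω ⊢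
        exact fr_mem (inLat_add hω.1 h0)
      · intro ω hω
        rw [Set.Finite.mem_toFinset] at hω ⊢
        exact fr_mem (inLat_sub hω.1 h0)
      · intro ω hω
        rw [Set.Finite.mem_toFinset] at hω
        conv_rhs => rw [← fr_self hω]
        refine fr_congr (fun i => -⌊(ω + ω₀) i⌋) fun i => ?_
        rw [fr_eq]; simp only [Pi.add_apply, Pi.sub_apply, Int.cast_neg]; ring
      · intro ω hω
        rw [Set.Finite.mem_toFinset] at hω
        conv_rhs => rw [← fr_self hω]
        refine fr_congr (fun i => -⌊(ω - ω₀) i⌋) fun i => ?_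
        rw [fr_eq]; simp only [Pi.add_apply, Pi.sub_apply, Int.cast_neg]; ring
      · intro ω _
        rw [ech_fr, smul_add, ech_add_right]
    have h3 : S * (ech j ((2 * Real.pi) • ω₀) - 1) = 0 := by linear_combination -h2
    exact (mul_eq_zero.mp h3).resolve_right (sub_ne_zero.mpr h1)

/-- square-summable sequences -/
noncomputable abbrev L2 (d : ℕ) := lp (fun _ : Fin d → ℤ => ℂ) 2

lemma memL2_iff {d : ℕ} (v : (Fin d → ℤ) → ℂ) :
    Memℓp v 2 ↔ Summable fun k => ‖v k‖ ^ 2 := by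
  rw [memℓp_gen_iff (by norm_num)]
  simp

lemma L2_norm_sq {d : ℕ} (v : L2 d) : ‖v‖ ^ 2 = ∑' k, ‖v k‖ ^ 2 := by
  have := lp.norm_rpow_eq_tsum (p := 2) (by norm_num) v
  simpa using this

lemma L2_summable {d : ℕ} (v : L2 d) : Summable fun k => ‖v k‖ ^ 2 :=
  (memL2_iff _).mp (lp.memℓp v)

/-- composition with an injective map -/
noncomputable def compL {d : ℕ} (g : (Fin d → ℤ) → (Fin d → ℤ)) (hg : Function.Injective g) :
    L2 d →L[ℂ] L2 d :=
  LinearMap.mkContinuous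
    { toFun := fun v => ⟨fun k => v (g k), (memL2_iff _).mpr ((L2_summable v).comp_injective hg)⟩
      map_add' := fun v w => rfl
      map_smul' := fun c v => rfl } 1 (by
    intro v
    rw [one_mul]
    refine (sq_le_sq₀ (norm_nonneg _) (norm_nonneg _)).mp ?_
    rw [L2_norm_sq, L2_norm_sq]
    exact Summable.tsum_le_tsum_of_inj g hg (fun _ _ => by positivity) (fun _ => le_rfl)
      ((L2_summable v).comp_injective hg) (L2_summable v))

lemma compL_apply {d : ℕ} (g : (Fin d → ℤ) → (Fin d → ℤ)) (hg : Function.Injective g)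
    (v : L2 d) (k : Fin d → ℤ) : compL g hg v k = v (g k) := rfl

lemma compL_norm {d : ℕ} (g : (Fin d → ℤ) → (Fin d → ℤ)) (hg : Function.Injective g) :
    ‖compL g hg‖ ≤ 1 := LinearMap.mkContinuous_norm_le _ zero_le_one _

lemma shift_inj {d : ℕ} {N : Matrix (Fin d) (Fin d) ℤ} (hN : N.det ≠ 0) (j : Fin d → ℤ) :
    Function.Injective fun k => j + N.mulVec k := fun _ _ h =>
  Matrix.mulVec_injective_of_det_ne_zero hN (add_left_cancel h)

/-- analysis operator -/
noncomputable def anaL {d : ℕ} (u : (Fin d → ℤ) → ℂ) {N : Matrix (Fin d) (Fin d) ℤ}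
    (hN : N.det ≠ 0) : L2 d →L[ℂ] L2 d :=
  ∑' j, starRingEnd ℂ (u j) • compL (fun k => j + N.mulVec k) (shift_inj hN j)

lemma anaL_apply {d : ℕ} {u : (Fin d → ℤ) → ℂ} (hu : Summable fun k => ‖u k‖)
    {N : Matrix (Fin d) (Fin d) ℤ} (hN : N.det ≠ 0) (v : L2 d) (k : Fin d → ℤ) :
    anaL u hN v k = ∑' j, starRingEnd ℂ (u j) * v (j + N.mulVec k) := by
  have hs : Summable fun j =>
      starRingEnd ℂ (u j) • compL (fun k => j + N.mulVec k) (shift_inj hN j) := by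
    refine Summable.of_norm_bounded hu fun j => ?_
    rw [norm_smul, RCLike.norm_conj]
    exact mul_le_of_le_one_right (norm_nonneg _) (compL_norm _ _)
  let φ : (L2 d →L[ℂ] L2 d) →L[ℂ] ℂ :=
    (lp.evalCLM ℂ (fun _ : Fin d → ℤ => ℂ) 2 k).comp (ContinuousLinearMap.apply ℂ (L2 d) v)
  have := (hs.hasSum.mapL φ).tsum_eq
  exact this.symm

lemma anaL_ip {d : ℕ} {u : (Fin d → ℤ) → ℂ} (hu : Summable fun k => ‖u k‖)
    {N : Matrix (Fin d) (Fin d) ℤ} (hN : N.det ≠ 0) (v : L2 d) (c : ℝ) (k : Fin d → ℤ) :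
    ip v (fun x => (c : ℂ) * u (x - N.mulVec k)) = c * anaL u hN v k := by
  rw [anaL_apply hu, ip, ← (Equiv.addRight (N.mulVec k)).tsum_eq, ← tsum_mul_left]
  refine tsum_congr fun j => ?_
  simp
  ring

lemma anaL_single {d : ℕ} {u : (Fin d → ℤ) → ℂ} (hu : Summable fun k => ‖u k‖)
    {N : Matrix (Fin d) (Fin d) ℤ} (hN : N.det ≠ 0) (n k : Fin d → ℤ) :
    anaL u hN (lp.single 2 n (1 : ℂ)) k = starRingEnd ℂ (u (n - N.mulVec k)) := by
  rw [anaL_apply hu, tsum_eq_single (n - N.mulVec k)]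
  · simp
  · intro j hj
    rw [lp.single_apply_ne, mul_zero]
    rintro rfl
    simp at hj

lemma frame_iff {d : ℕ} {ι : Type*} [Fintype ι] (u : ι → (Fin d → ℤ) → ℂ)
    (hu : ∀ i, Summable fun k => ‖u i k‖) (N : ι → Matrix (Fin d) (Fin d) ℤ)
    (hN : ∀ i, (N i).det ≠ 0) :
    (∀ v : (Fin d → ℤ) → ℂ, Summable (fun k => ‖v k‖ ^ 2) →
      ∑' k : Fin d → ℤ, ‖v k‖ ^ 2 =
        ∑ i, ∑' k : Fin d → ℤ,
          ‖ip v (fun x => (Real.sqrt (|(N i).det| : ℝ) : ℂ) * u i (x - (N i).mulVec k))‖ ^ 2) ↔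
    ∀ m n : Fin d → ℤ, ∑ i, ((|((N i).det : ℝ)| : ℝ) : ℂ) *
      ∑' k, u i (m - (N i).mulVec k) * starRingEnd ℂ (u i (n - (N i).mulVec k)) =
        if m = n then 1 else 0 := by
  let S : L2 d →L[ℂ] L2 d := ∑ i, ((|((N i).det : ℝ)| : ℝ) : ℂ) •
    ((ContinuousLinearMap.adjoint (anaL (u i) (hN i))).comp (anaL (u i) (hN i)))
  have hS : ∀ v w : L2 d, inner ℂ v (S w) = ∑ i, ((|((N i).det : ℝ)| : ℝ) : ℂ) *
      inner ℂ (anaL (u i) (hN i) v) (anaL (u i) (hN i) w) := by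
    intro v w
    simp only [S, sum_apply, inner_sum, smul_apply,
      inner_smul_right, ContinuousLinearMap.comp_apply, ContinuousLinearMap.adjoint_inner_right]
  have h1 : (∀ v : (Fin d → ℤ) → ℂ, Summable (fun k => ‖v k‖ ^ 2) →
      ∑' k : Fin d → ℤ, ‖v k‖ ^ 2 =
        ∑ i, ∑' k : Fin d → ℤ,
          ‖ip v (fun x => (Real.sqrt (|(N i).det| : ℝ) : ℂ) * u i (x - (N i).mulVec k))‖ ^ 2) ↔
      ∀ v : L2 d, ‖v‖ ^ 2 = ∑ i, |((N i).det : ℝ)| * ‖anaL (u i) (hN i) v‖ ^ 2 := by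
    have key : ∀ v : L2 d, (∑ i, ∑' k : Fin d → ℤ,
          ‖ip v (fun x => (Real.sqrt (|(N i).det| : ℝ) : ℂ) * u i (x - (N i).mulVec k))‖ ^ 2) =
          ∑ i, |((N i).det : ℝ)| * ‖anaL (u i) (hN i) v‖ ^ 2 := by
      intro v
      refine Finset.sum_congr rfl fun i _ => ?_
      rw [L2_norm_sq, ← tsum_mul_left]
      refine tsum_congr fun k => ?_
      rw [anaL_ip (hu i) (hN i), norm_mul, mul_pow, Complex.norm_real, Real.norm_eq_abs, sq_abs,
        Real.sq_sqrt (abs_nonneg _)]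
    constructor
    · intro h v
      rw [← key v, L2_norm_sq]
      exact h v (L2_summable v)
    · intro h v hv
      have := h ⟨v, (memL2_iff v).mpr hv⟩
      rw [← key, L2_norm_sq] at this
      exact this
  rw [h1]
  have h2 : (∀ v : L2 d, ‖v‖ ^ 2 = ∑ i, |((N i).det : ℝ)| * ‖anaL (u i) (hN i) v‖ ^ 2) ↔
      S = ContinuousLinearMap.id ℂ (L2 d) := by
    have h3 : ∀ v : L2 d, inner ℂ v (S v) =
        ((∑ i, |((N i).det : ℝ)| * ‖anaL (u i) (hN i) v‖ ^ 2 : ℝ) : ℂ) := by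
      intro v
      rw [hS]
      push_cast
      refine Finset.sum_congr rfl fun i _ => ?_
      rw [inner_self_eq_norm_sq_to_K]
      rfl
    constructor
    · intro h
      have h4 := (inner_map_self_eq_zero
        ((S - ContinuousLinearMap.id ℂ (L2 d) : L2 d →L[ℂ] L2 d) : L2 d →ₗ[ℂ] L2 d)).mp (by
        intro v
        rw [← inner_conj_symm]
        have h5 : inner ℂ v (((S - ContinuousLinearMap.id ℂ (L2 d) : L2 d →L[ℂ] L2 d) :
            L2 d →ₗ[ℂ] L2 d) v) = inner ℂ v (S v) - inner ℂ v v := by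
          rw [← inner_sub_right]; rfl
        rw [h5, h3, ← h v, inner_self_eq_norm_sq_to_K]
        simp)
      have h6 : S - ContinuousLinearMap.id ℂ (L2 d) = 0 := by
        ext1 v
        exact congrFun (congrArg DFunLike.coe h4) v
      exact sub_eq_zero.mp h6
    · intro h v
      have h4 := h3 v
      rw [h, ContinuousLinearMap.id_apply, inner_self_eq_norm_sq_to_K] at h4
      apply Complex.ofReal_injective
      rw [← h4]
      push_cast
      rfl
  rw [h2]
  have h3 : ∀ m n : Fin d → ℤ, (S (lp.single 2 n (1 : ℂ))) m =
      ∑ i, ((|((N i).det : ℝ)| : ℝ) : ℂ) *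
      ∑' k, u i (m - (N i).mulVec k) * starRingEnd ℂ (u i (n - (N i).mulVec k)) := by
    intro m n
    have h4 := lp.inner_single_left (𝕜 := ℂ) m (1 : ℂ) (S (lp.single 2 n (1 : ℂ)))
    rw [hS] at h4
    have h5 : inner ℂ (1 : ℂ) ((S (lp.single 2 n (1 : ℂ))) m) = (S (lp.single 2 n (1 : ℂ))) m := by
      simp
    rw [← h5, ← h4]
    refine Finset.sum_congr rfl fun i _ => ?_
    congr 1
    rw [lp.inner_eq_tsum]
    refine tsum_congr fun k => ?_
    rw [anaL_single (hu i), anaL_single (hu i)]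
    simp [mul_comm]
  have hsing : ∀ m n : Fin d → ℤ, (lp.single 2 n (1 : ℂ) : L2 d) m = if m = n then 1 else 0 := by
    intro m n
    rw [lp.single_apply, Pi.single_apply]
  constructor
  · intro h m n
    rw [← h3, h, ContinuousLinearMap.id_apply, hsing]
  · intro h
    have h4 : ∀ n, S (lp.single 2 n (1 : ℂ)) = lp.single 2 n (1 : ℂ) := by
      intro n
      ext m
      rw [h3, h, hsing]
    ext1 v
    have h5 := lp.hasSum_single (p := 2) (by norm_num) v
    have h6 := h5.mapL S
    refine h6.unique ?_
    have h7 : ∀ n, S (lp.single 2 n (v n)) = lp.single 2 n (v n) := fun n => by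
      have : (lp.single 2 n (v n) : L2 d) = v n • lp.single 2 n (1 : ℂ) := by
        rw [← lp.single_smul]; simp
      rw [this, map_smul, h4]
    simp only [h7]
    exact h5

lemma ae_iff_coeff {d : ℕ} {ι : Type*} [Fintype ι] (u : ι → (Fin d → ℤ) → ℂ)
    (hu : ∀ i, Summable fun k => ‖u i k‖) (χ : ι → ℂ) (ω : Fin d → ℝ) (z : ℂ) :
    (∀ᵐ ξ : Fin d → ℝ ∂volume, ∑ i, χ i * fserd (u i) ξ *
      starRingEnd ℂ (fserd (u i) (ξ + (2 * Real.pi) • ω)) = z) ↔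
    ∀ p, ∑ i, χ i * corr (u i) ω p = if p = 0 then z else 0 := by
  let c : (Fin d → ℤ) → ℂ := fun p => ∑ i, χ i * corr (u i) ω p - (Pi.single 0 z : _ → ℂ) p
  have hs1 : Summable fun p : Fin d → ℤ => ‖(Pi.single 0 z : (Fin d → ℤ) → ℂ) p‖ := by
    refine summable_of_ne_finset_zero (s := {0}) fun p hp => ?_
    have : p ≠ 0 := by simpa using hp
    simp [this]
  have hs2 : ∀ i, Summable fun p => ‖χ i * corr (u i) ω p‖ := fun i => by
    simpa only [norm_mul] using (corr_summable (hu i) ω).mul_left ‖χ i‖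
  have hs3 : Summable fun p => ‖∑ i, χ i * corr (u i) ω p‖ :=
    Summable.of_nonneg_of_le (fun _ => norm_nonneg _) (fun p => norm_sum_le _ _)
      (summable_sum fun i _ => hs2 i)
  have hc : Summable fun p => ‖c p‖ :=
    Summable.of_nonneg_of_le (fun _ => norm_nonneg _) (fun p => norm_sub_le _ _) (hs3.add hs1)
  have hf : ∀ ξ, fserd c ξ = ∑ i, χ i * fserd (u i) ξ *
      starRingEnd ℂ (fserd (u i) (ξ + (2 * Real.pi) • ω)) - z := by
    intro ξ
    conv_rhs => rw [← fserd_single z ξ]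
    simp only [mul_assoc, fserd_mul_conj (hu _)]
    simp only [fserd_eq, c, sub_mul]
    rw [Summable.tsum_sub (summable_ech hs3 ξ) (summable_ech hs1 ξ)]
    congr 1
    simp only [Finset.sum_mul]
    rw [Summable.tsum_finsetSum (fun i _ => summable_ech (hs2 i) ξ)]
    refine Finset.sum_congr rfl fun i _ => ?_
    rw [← tsum_mul_left]
    exact tsum_congr fun p => by ring
  have hcz : c = 0 ↔ ∀ p, ∑ i, χ i * corr (u i) ω p = if p = 0 then z else 0 := by
    rw [funext_iff]
    refine forall_congr' fun p => ?_
    simp only [c, Pi.zero_apply, sub_eq_zero, Pi.single_apply]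
  rw [← hcz]
  constructor
  · intro h
    refine coeff_zero_of_ae hc ?_
    filter_upwards [h] with ξ hξ
    rw [hf, hξ, sub_self]
  · intro h
    refine Filter.Eventually.of_forall fun ξ => ?_
    have := hf ξ
    rw [h] at this
    have h0 : fserd (0 : (Fin d → ℤ) → ℂ) ξ = 0 := by simp [fserd_eq]
    rw [h0] at this
    exact sub_eq_zero.mp this.symm

lemma corr_periodize {d : ℕ} {u : (Fin d → ℤ) → ℂ} (hu : Summable fun k => ‖u k‖)
    {N : Matrix (Fin d) (Fin d) ℤ} (hN : N.det ≠ 0) (n p : Fin d → ℤ) :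
    ((|(N.det : ℝ)| : ℝ) : ℂ) *
      ∑' k, u (n + p - N.mulVec k) * starRingEnd ℂ (u (n - N.mulVec k)) =
    ∑ ω ∈ (finite_Omega hN).toFinset, corr u ω p * ech n ((2 * Real.pi) • ω) := by
  have hs : ∀ ω : Fin d → ℝ, Summable fun j => u (j + p) * starRingEnd ℂ (u j) *
      ech (-j) ((2 * Real.pi) • ω) := fun ω => by
    apply Summable.of_norm
    simpa [norm_ech] using (corr_summable_prod hu).prod_factor p
  have h1 : ∑ ω ∈ (finite_Omega hN).toFinset, corr u ω p * ech n ((2 * Real.pi) • ω) =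
      ∑' j, u (j + p) * starRingEnd ℂ (u j) *
        if ∃ k, n - j = N.mulVec k then ((|(N.det : ℝ)| : ℝ) : ℂ) else 0 := by
    simp only [corr, ← tsum_mul_right]
    rw [← Summable.tsum_finsetSum (fun ω _ => (hs ω).mul_right _)]
    refine tsum_congr fun j => ?_
    rw [← sum_Omega hN, Finset.mul_sum]
    refine Finset.sum_congr rfl fun ω _ => ?_
    rw [sub_eq_add_neg, ech_add]
    ring
  rw [h1]
  have hinj : Function.Injective fun k => n - N.mulVec k := fun k l h =>
    Matrix.mulVec_injective_of_det_ne_zero hN (sub_right_injective h)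
  rw [← hinj.tsum_eq (f := fun j => u (j + p) * starRingEnd ℂ (u j) *
        if ∃ k, n - j = N.mulVec k then ((|(N.det : ℝ)| : ℝ) : ℂ) else 0), ← tsum_mul_left]
  · refine tsum_congr fun k => ?_
    rw [if_pos ⟨k, by simp⟩, show n - N.mulVec k + p = n + p - N.mulVec k by abel]
    ring
  · intro j hj
    rw [Function.mem_support] at hj
    by_contra hc
    apply hj
    rw [if_neg, mul_zero]
    rintro ⟨k, hk⟩
    exact hc ⟨k, by simp [← hk]⟩

/-- The character of `ℤ^d` attached to `ω`. -/
noncomputable def chHom {d : ℕ} (ω : Fin d → ℝ) : Multiplicative (Fin d → ℤ) →* ℂ where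
  toFun n := ech n.toAdd ((2 * Real.pi) • ω)
  map_one' := ech_zero_left _
  map_mul' _ _ := ech_add _ _ _

lemma chHom_inj {d : ℕ} {x y : Fin d → ℝ} (hx : ∀ i, x i ∈ Set.Ico (0 : ℝ) 1)
    (hy : ∀ i, y i ∈ Set.Ico (0 : ℝ) 1) (h : chHom x = chHom y) : x = y := by
  funext i
  have h1 : ech (Pi.single i 1) ((2 * Real.pi) • x) = ech (Pi.single i 1) ((2 * Real.pi) • y) :=
    DFunLike.congr_fun h (Multiplicative.ofAdd (Pi.single i 1))
  have h2 : ech (Pi.single i 1) ((2 * Real.pi) • (x - y)) = 1 := by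
    have h3 : x = (x - y) + y := by simp
    rw [h3, smul_add, ech_add_right] at h1
    have h4 : ech (Pi.single i 1) ((2 * Real.pi) • y) ≠ 0 := by
      rw [← norm_ne_zero_iff, norm_ech]; exact one_ne_zero
    exact mul_right_cancel₀ h4 (by rw [h1, one_mul])
  obtain ⟨n, hn⟩ := ech_eq_one h2
  rw [Finset.sum_eq_single i (by intro b _ hb; simp [hb]) (by simp)] at hn
  simp only [Pi.single_eq_same, Int.cast_one, one_mul, Pi.sub_apply] at hn
  have h5 := hx i
  have h6 := hy i
  have h7 : n = 0 := by
    have a1 : (n : ℝ) < 1 := by rw [← hn]; linarith [h5.2, h6.1]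
    have a2 : (-1 : ℝ) < n := by rw [← hn]; linarith [h5.1, h6.2]
    have a3 : n < 1 := by exact_mod_cast a1
    have a4 : -1 < n := by exact_mod_cast a2
    omega
  rw [h7] at hn
  simp at hn
  linarith

lemma ech_indep {d : ℕ} (Ω : Finset (Fin d → ℝ)) (hΩ : ∀ ω ∈ Ω, ∀ i, ω i ∈ Set.Ico (0 : ℝ) 1)
    (c : (Fin d → ℝ) → ℂ) (h : ∀ n : Fin d → ℤ, ∑ ω ∈ Ω, c ω * ech n ((2 * Real.pi) • ω) = 0) :
    ∀ ω ∈ Ω, c ω = 0 := by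
  have hli := (linearIndependent_monoidHom (Multiplicative (Fin d → ℤ)) ℂ).comp
    (fun ω : Ω => chHom ω.1) (fun x y hxy =>
      Subtype.ext (chHom_inj (hΩ _ x.2) (hΩ _ y.2) hxy))
  have := Fintype.linearIndependent_iff.mp hli (fun ω => c ω.1) (by
    funext n
    have h1 := h n.toAdd
    rw [← Finset.sum_coe_sort] at h1
    simpa [chHom] using h1)
  intro ω hω
  exact this ⟨ω, hω⟩

lemma main_general {d : ℕ} {ι : Type*} [Fintype ι] (u : ι → (Fin d → ℤ) → ℂ)
    (hu : ∀ i, Summable fun k => ‖u i k‖) (N : ι → Matrix (Fin d) (Fin d) ℤ)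
    (hN : ∀ i, (N i).det ≠ 0) :
    ((∀ᵐ ξ : Fin d → ℝ ∂volume, ∑ i, ‖fserd (u i) ξ‖ ^ 2 = 1) ∧
      ∀ ω ∈ (⋃ i, Omega (N i)) \ {0},
        ∀ᵐ ξ : Fin d → ℝ ∂volume,
            ∑ i, (if inLat (N i) ω then (1 : ℂ) else 0) * fserd (u i) ξ *
              starRingEnd ℂ (fserd (u i) (ξ + (2 * Real.pi) • ω)) = 0)
    ↔
    (∀ v : (Fin d → ℤ) → ℂ, Summable (fun k => ‖v k‖ ^ 2) →
      ∑' k : Fin d → ℤ, ‖v k‖ ^ 2 =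
        ∑ i, ∑' k : Fin d → ℤ,
          ‖ip v (fun x => (Real.sqrt (|(N i).det| : ℝ) : ℂ) *
            u i (x - (N i).mulVec k))‖ ^ 2) := by
  rw [frame_iff u hu N hN]
  let C : (Fin d → ℝ) → (Fin d → ℤ) → ℂ := fun ω p =>
    ∑ i, (if inLat (N i) ω then (1 : ℂ) else 0) * corr (u i) ω p
  let Ω : Finset (Fin d → ℝ) := insert 0 (Finset.univ.biUnion fun i => (finite_Omega (hN i)).toFinset)
  have hΩ : ∀ ω ∈ Ω, ∀ i, ω i ∈ Set.Ico (0 : ℝ) 1 := by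
    intro ω hω i
    simp only [Ω, Finset.mem_insert, Finset.mem_biUnion, Finset.mem_univ, true_and,
      Set.Finite.mem_toFinset] at hω
    rcases hω with rfl | ⟨l, hl⟩
    · simp
    · exact hl.2 i
  have h0 : (∀ᵐ ξ : Fin d → ℝ ∂volume, ∑ i, ‖fserd (u i) ξ‖ ^ 2 = 1) ↔
      ∀ p, C 0 p = if p = 0 then 1 else 0 := by
    rw [← ae_iff_coeff u hu (fun i => if inLat (N i) 0 then (1 : ℂ) else 0) 0 1]
    refine Filter.eventually_congr (Filter.Eventually.of_forall fun ξ => ?_)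
    simp only [inLat_zero, if_true, one_mul, smul_zero, add_zero, Complex.mul_conj']
    norm_cast
  have h1 : (∀ ω ∈ (⋃ i, Omega (N i)) \ {0},
        ∀ᵐ ξ : Fin d → ℝ ∂volume,
            ∑ i, (if inLat (N i) ω then (1 : ℂ) else 0) * fserd (u i) ξ *
              starRingEnd ℂ (fserd (u i) (ξ + (2 * Real.pi) • ω)) = 0) ↔
      ∀ ω ∈ (⋃ i, Omega (N i)) \ {0}, ∀ p, C ω p = 0 := by
    refine forall₂_congr fun ω _ => ?_
    rw [ae_iff_coeff u hu (fun i => if inLat (N i) ω then (1 : ℂ) else 0) ω 0]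
    simp [C]
  rw [h0, h1]
  have h2 : ((∀ p, C 0 p = if p = 0 then 1 else 0) ∧
      ∀ ω ∈ (⋃ i, Omega (N i)) \ {0}, ∀ p, C ω p = 0) ↔
      ∀ ω ∈ Ω, ∀ p, C ω p - (if ω = 0 then (if p = 0 then 1 else 0) else 0) = 0 := by
    constructor
    · rintro ⟨ha, hb⟩ ω hω p
      by_cases hz : ω = 0
      · subst hz; rw [ha, if_pos rfl, sub_self]
      · rw [if_neg hz, sub_zero]
        refine hb ω ⟨?_, hz⟩ p
        simpa [Ω, hz] using hω
    · intro h
      refine ⟨fun p => ?_, fun ω hω p => ?_⟩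
      · have := h 0 (Finset.mem_insert_self _ _) p
        rwa [if_pos rfl, sub_eq_zero] at this
      · have hz : ω ≠ 0 := hω.2
        have := h ω (by simpa [Ω, hz] using hω.1) p
        rwa [if_neg hz, sub_zero] at this
  rw [h2]
  have h3 : ∀ n p : Fin d → ℤ, ∑ i, ((|((N i).det : ℝ)| : ℝ) : ℂ) *
      ∑' k, u i (n + p - (N i).mulVec k) * starRingEnd ℂ (u i (n - (N i).mulVec k)) =
      ∑ ω ∈ Ω, C ω p * ech n ((2 * Real.pi) • ω) := by
    intro n p
    simp only [C, Finset.sum_mul]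
    rw [Finset.sum_comm]
    refine Finset.sum_congr rfl fun i _ => ?_
    rw [corr_periodize (hu i) (hN i)]
    have hsub : (finite_Omega (hN i)).toFinset ⊆ Ω := fun ω hω =>
      Finset.mem_insert_of_mem (Finset.mem_biUnion.mpr ⟨i, Finset.mem_univ _, hω⟩)
    rw [← Finset.sum_subset hsub]
    · refine Finset.sum_congr rfl fun ω hω => ?_
      rw [if_pos ((Set.Finite.mem_toFinset _).mp hω).1, one_mul]
    · intro ω hω hn
      rw [if_neg, zero_mul, zero_mul]
      intro hl
      exact hn ((Set.Finite.mem_toFinset _).mpr ⟨hl, hΩ ω hω⟩)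
  have h4 : ∀ n p : Fin d → ℤ, ∑ ω ∈ Ω,
      (C ω p - (if ω = 0 then (if p = 0 then 1 else 0) else 0)) * ech n ((2 * Real.pi) • ω) =
      ∑ ω ∈ Ω, C ω p * ech n ((2 * Real.pi) • ω) - if p = 0 then 1 else 0 := by
    intro n p
    simp only [sub_mul, Finset.sum_sub_distrib]
    congr 1
    rw [Finset.sum_eq_single 0]
    · simp [ech_zero_right]
    · intro ω _ hω; simp [hω]
    · intro h; exact absurd (Finset.mem_insert_self _ _) h
  constructor
  · intro h m n
    have h5 := h3 n (m - n)
    have h6 := h4 n (m - n)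
    rw [Finset.sum_eq_zero (fun ω hω => by rw [h ω hω, zero_mul])] at h6
    rw [add_sub_cancel] at h5
    rw [h5]
    simp only [sub_eq_zero] at h6
    exact sub_eq_zero.mp h6.symm
  · intro h ω hω p
    refine ech_indep Ω hΩ (fun ω => C ω p - (if ω = 0 then (if p = 0 then 1 else 0) else 0))
      (fun n => ?_) ω hω
    rw [h4, ← h3, h]
    simp

theorem tight_framelet_filter_bank_iff_one_level_tight_frame
    {d s : ℕ} (a : (Fin d → ℤ) → ℂ) (b : Fin s → (Fin d → ℤ) → ℂ)
    (ha : Summable fun k => ‖a k‖) (hb : ∀ ℓ, Summable fun k => ‖b ℓ k‖)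
    (M : Matrix (Fin d) (Fin d) ℤ) (Ml : Fin s → Matrix (Fin d) (Fin d) ℤ)
    (hM : M.det ≠ 0) (hMl : ∀ ℓ, (Ml ℓ).det ≠ 0) :
    ((∀ᵐ ξ : Fin d → ℝ ∂volume,
        ‖fserd a ξ‖ ^ 2 + ∑ ℓ : Fin s, ‖fserd (b ℓ) ξ‖ ^ 2 = 1) ∧
      ∀ ω ∈ (Omega M ∪ ⋃ ℓ : Fin s, Omega (Ml ℓ)) \ {0},
        ∀ᵐ ξ : Fin d → ℝ ∂volume,
          (if inLat M ω then (1 : ℂ) else 0) * fserd a ξ *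
              starRingEnd ℂ (fserd a (ξ + (2 * Real.pi) • ω)) +
            ∑ ℓ : Fin s, (if inLat (Ml ℓ) ω then (1 : ℂ) else 0) * fserd (b ℓ) ξ *
              starRingEnd ℂ (fserd (b ℓ) (ξ + (2 * Real.pi) • ω)) = 0)
    ↔
    (∀ v : (Fin d → ℤ) → ℂ, Summable (fun k => ‖v k‖ ^ 2) →
      ∑' k : Fin d → ℤ, ‖v k‖ ^ 2 =
        (∑' k : Fin d → ℤ,
          ‖ip v (fun x => (Real.sqrt (|M.det| : ℝ) : ℂ) * a (x - M.mulVec k))‖ ^ 2) +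
        ∑ ℓ : Fin s, ∑' k : Fin d → ℤ,
          ‖ip v (fun x => (Real.sqrt (|(Ml ℓ).det| : ℝ) : ℂ) *
            b ℓ (x - (Ml ℓ).mulVec k))‖ ^ 2) := by
  have key := main_general (fun o : Option (Fin s) => o.elim a b)
    (fun o => by cases o <;> simp [ha, hb]) (fun o => o.elim M Ml)
    (fun o => by cases o <;> simp [hM, hMl])
  simp only [Fintype.sum_option, Option.elim_none, Option.elim_some, Set.iUnion_option] at key
  exact key
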